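/- For every t ∈ (0,1) there exist a nonempty compact set K ⊂ U and a continuous surjection ι : K → ({0,1,2,3}^ℕ) such that: (i) for every p ∈ K the denominator (f_t)₃ does not vanish at (p₁,p₂,1), so F_t(p) is defined, and F_t(p) ∈ K; and (ii) ι ∘ (F_t restricted to K) = σ ∘ ι, where σ is the one-sided shift σ((i_n)_{n≥0}) = (i_{n+1})_{n≥0} on the space {0,1,2,3}^ℕ of sequences in four symbols (with the product topology). In particular F_t restricted to K is topologically semiconjugate to the full one-sided 4-shift, so the topological entropy of F_t on K is log 4. -/

import Mathlib

/-- ρ₁(x) = −x₁ + x₂ + x₃ -/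
def rho1 (x : ℝ × ℝ × ℝ) : ℝ := -x.1 + x.2.1 + x.2.2
/-- ρ₂(x) = x₁ − x₂ + x₃ -/
def rho2 (x : ℝ × ℝ × ℝ) : ℝ := x.1 - x.2.1 + x.2.2
/-- ρ₃(x) = x₁ + x₂ − x₃ -/
def rho3 (x : ℝ × ℝ × ℝ) : ℝ := x.1 + x.2.1 - x.2.2
/-- Homogeneous representative of the rational map f = g∘h. -/
def fmap (x : ℝ × ℝ × ℝ) : ℝ × ℝ × ℝ :=
  (x.1 ^ 2 * rho1 x ^ 2, x.2.1 ^ 2 * rho2 x ^ 2, x.2.2 ^ 2 * rho3 x ^ 2)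
/-- Homogeneous representative of the perturbed map f_t = T_t∘f. -/
noncomputable def ft (t : ℝ) (x : ℝ × ℝ × ℝ) : ℝ × ℝ × ℝ :=
  fmap x - ((1 - t) / 3 * ((fmap x).1 + (fmap x).2.1 + (fmap x).2.2)) •
    ((1 : ℝ), (1 : ℝ), (1 : ℝ))
/-- Affine-chart representation of f_t. -/
noncomputable def Ft (t : ℝ) (p : ℝ × ℝ) : ℝ × ℝ :=
  ((ft t (p.1, p.2, 1)).1 / (ft t (p.1, p.2, 1)).2.2,
   (ft t (p.1, p.2, 1)).2.1 / (ft t (p.1, p.2, 1)).2.2)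

/-- U = {(x,y) ∈ ℝ² : x² + y² + 1 − 2(xy + x + y) < 0}. -/
def U : Set (ℝ × ℝ) :=
  {p | p.1 ^ 2 + p.2 ^ 2 + 1 - 2 * (p.1 * p.2 + p.1 + p.2) < 0}


/-- Abstract horseshoe lemma. -/
theorem horseshoe {X : Type*} [TopologicalSpace X] [T2Space X] (F : X → X)
    (E : Fin 4 → Set X) (ψ : Fin 4 → X → X) (x0 : X)
    (hx0 : x0 ∈ ⋃ i, E i)
    (hc : ∀ i, IsCompact (E i)) (hd : ∀ i j p, p ∈ E i → p ∈ E j → i = j)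
    (hF : ContinuousOn F (⋃ i, E i))
    (hψ : ∀ i, ∀ p ∈ ⋃ j, E j, ψ i p ∈ E i ∧ F (ψ i p) = p) :
    ∃ K : Set X, K.Nonempty ∧ IsCompact K ∧ K ⊆ ⋃ i, E i ∧
      ∃ ι : X → (ℕ → Fin 4),
        ContinuousOn ι K ∧
        (∀ s : ℕ → Fin 4, ∃ p ∈ K, ι p = s) ∧
        (∀ p ∈ K, F p ∈ K) ∧
        (∀ p ∈ K, ι (F p) = fun n => ι p (n + 1)) := by
  classical
  set A : Set X := ⋃ i, E i with hA
  have hAc : IsCompact A := isCompact_iUnion hc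
  have hEA : ∀ i, E i ⊆ A := fun i => Set.subset_iUnion E i
  -- cylinder sets
  let cyl : ℕ → (ℕ → Fin 4) → Set X := fun n s => {p | ∀ k ≤ n, F^[k] p ∈ E (s k)}
  have cyl_succ : ∀ n s, cyl (n + 1) s = E (s 0) ∩ F ⁻¹' (cyl n (fun k => s (k + 1))) := by
    intro n s
    ext p
    constructor
    · intro h
      refine ⟨h 0 (Nat.zero_le _), fun k hk => ?_⟩
      have := h (k + 1) (by omega)
      rwa [Function.iterate_succ_apply] at this
    · rintro ⟨h0, h1⟩ k hk
      cases k with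
      | zero => exact h0
      | succ k =>
        rw [Function.iterate_succ_apply]
        exact h1 k (by omega)
  have cyl_zero : ∀ s, cyl 0 s = E (s 0) := by
    intro s
    ext p
    constructor
    · intro h
      exact h 0 le_rfl
    · intro h k hk
      obtain rfl : k = 0 := by omega
      exact h
  have cyl_closed : ∀ n s, IsClosed (cyl n s) := by
    intro n
    induction n with
    | zero => intro s; rw [cyl_zero]; exact (hc _).isClosed
    | succ n ih =>
      intro s
      rw [cyl_succ]
      exact (hF.mono (hEA _)).preimage_isClosed_of_isClosed (hc _).isClosed (ih _)
  have cyl_ne : ∀ n s, (cyl n s).Nonempty ∧ cyl n s ⊆ A := by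
    intro n
    induction n with
    | zero => intro s; rw [cyl_zero]; exact ⟨⟨_, (hψ (s 0) x0 hx0).1⟩, hEA _⟩
    | succ n ih =>
      intro s
      rw [cyl_succ]
      obtain ⟨⟨p, hp⟩, hs⟩ := ih (fun k => s (k + 1))
      have h := hψ (s 0) p (hs hp)
      refine ⟨⟨ψ (s 0) p, h.1, ?_⟩, fun q hq => hEA _ hq.1⟩
      rw [Set.mem_preimage, h.2]; exact hp
  -- finite time invariant sets
  let B : ℕ → Set X := fun n => {p | ∀ k ≤ n, F^[k] p ∈ A}
  have B_succ : ∀ n, B (n + 1) = A ∩ F ⁻¹' (B n) := by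
    intro n
    ext p
    constructor
    · intro h
      refine ⟨h 0 (Nat.zero_le _), fun k hk => ?_⟩
      have := h (k + 1) (by omega)
      rwa [Function.iterate_succ_apply] at this
    · rintro ⟨h0, h1⟩ k hk
      cases k with
      | zero => exact h0
      | succ k =>
        rw [Function.iterate_succ_apply]
        exact h1 k (by omega)
  have B_closed : ∀ n, IsClosed (B n) := by
    intro n
    induction n with
    | zero =>
      have : B 0 = A := by
        ext p
        constructor
        · intro h
          exact h 0 le_rfl
        · intro h k hk
          obtain rfl : k = 0 := by omega
          exact h
      rw [this]; exact hAc.isClosed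
    | succ n ih =>
      rw [B_succ]
      exact hF.preimage_isClosed_of_isClosed hAc.isClosed ih
  let K : Set X := {p | ∀ n, F^[n] p ∈ A}
  have hKA : K ⊆ A := fun p hp => hp 0
  have hKB : K = ⋂ n, B n := by
    ext p
    simp only [Set.mem_iInter]
    exact ⟨fun h n k _ => h k, fun h n => h n n le_rfl⟩
  have hKc : IsCompact K := by
    refine hAc.of_isClosed_subset ?_ hKA
    rw [hKB]
    exact isClosed_iInter B_closed
  have hKF : ∀ p ∈ K, F p ∈ K := by
    intro p hp n
    have := hp (n + 1)
    rwa [Function.iterate_succ_apply] at this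
  let idx : X → Fin 4 := fun p => if h : ∃ i, p ∈ E i then h.choose else 0
  have idx_eq : ∀ i p, p ∈ E i → idx p = i := by
    intro i p hp
    have h : ∃ i, p ∈ E i := ⟨i, hp⟩
    have : idx p = h.choose := dif_pos h
    rw [this]
    exact hd _ _ p h.choose_spec hp
  have idx_mem : ∀ p ∈ A, p ∈ E (idx p) := by
    intro p hp
    obtain ⟨i, hi⟩ := Set.mem_iUnion.1 hp
    rw [idx_eq i p hi]; exact hi
  have idx_cont : ContinuousOn idx A := by
    rw [continuousOn_iff_isClosed]
    intro t _
    refine ⟨⋃ i ∈ t, E i, ?_, ?_⟩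
    · exact Set.Finite.isClosed_biUnion (Set.toFinite t) (fun i _ => (hc i).isClosed)
    · ext p
      constructor
      · rintro ⟨h, hp⟩
        exact ⟨Set.mem_biUnion h (idx_mem p hp), hp⟩
      · rintro ⟨h, hp⟩
        obtain ⟨i, hi, hpi⟩ := Set.mem_iUnion₂.1 h
        refine ⟨?_, hp⟩
        change idx p ∈ t
        rw [idx_eq i p hpi]; exact hi
  have iter_cont : ∀ n, ContinuousOn (F^[n]) K := by
    intro n
    exact (hF.mono hKA).iterate hKF n
  have surj : ∀ s : ℕ → Fin 4, ∃ p ∈ K, (fun n => idx (F^[n] p)) = s := by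
    intro s
    have := IsCompact.nonempty_iInter_of_sequence_nonempty_isCompact_isClosed
      (fun n => cyl n s) (fun n p hp k hk => hp k (by omega))
      (fun n => (cyl_ne n s).1)
      (hAc.of_isClosed_subset (cyl_closed 0 s) (cyl_ne 0 s).2)
      (fun n => cyl_closed n s)
    obtain ⟨p, hp⟩ := this
    rw [Set.mem_iInter] at hp
    have h : ∀ n, F^[n] p ∈ E (s n) := fun n => hp n n le_rfl
    exact ⟨p, fun n => hEA _ (h n), funext fun n => idx_eq _ _ (h n)⟩
  obtain ⟨p0, hp0, _⟩ := surj (fun _ => 0)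
  refine ⟨K, ⟨p0, hp0⟩, hKc, hKA, fun p n => idx (F^[n] p), ?_, surj, hKF, ?_⟩
  · rw [continuousOn_pi]
    intro n
    exact idx_cont.comp (iter_cont n) (fun p hp => hp n)
  · intro p _
    funext n
    change idx (F^[n] (F p)) = idx (F^[n + 1] p)
    rw [Function.iterate_succ_apply]

/-- The quadratic form. -/
def Qf (a b c : ℝ) : ℝ := a ^ 2 + b ^ 2 + c ^ 2 - 2 * (a * b + b * c + c * a)

theorem Qf_pos_coords {a b c : ℝ} (h : Qf a b c < 0) (hs : 0 < a + b + c) :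
    0 < a ∧ 0 < b ∧ 0 < c := by
  unfold Qf at h
  have h1 : 0 < a * b := by nlinarith [sq_nonneg (a + b - c), sq_nonneg (a - b)]
  have h2 : 0 < b * c := by nlinarith [sq_nonneg (b + c - a)]
  have h3 : 0 < c * a := by nlinarith [sq_nonneg (c + a - b)]
  have ha : 0 < a * (a + b + c) := by nlinarith [sq_nonneg a]
  have hb : 0 < b * (a + b + c) := by nlinarith [sq_nonneg b]
  have hc : 0 < c * (a + b + c) := by nlinarith [sq_nonneg c]
  exact ⟨pos_of_mul_pos_left ha hs.le, pos_of_mul_pos_left hb hs.le,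
    pos_of_mul_pos_left hc hs.le⟩

theorem triangle {a b c : ℝ} (ha : 0 < a) (hb : 0 < b) (hc : 0 < c)
    (h : Qf (a ^ 2) (b ^ 2) (c ^ 2) < 0) :
    0 < -a + b + c ∧ 0 < a - b + c ∧ 0 < a + b - c := by
  have h0 : Qf (a ^ 2) (b ^ 2) (c ^ 2)
      = -((a + b + c) * ((-a + b + c) * (a - b + c) * (a + b - c))) := by
    unfold Qf; ring
  rw [h0] at h
  have h1 : 0 < (-a + b + c) * (a - b + c) * (a + b - c) := by
    by_contra hn
    have : (a + b + c) * ((-a + b + c) * (a - b + c) * (a + b - c)) ≤ 0 :=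
      mul_nonpos_of_nonneg_of_nonpos (by positivity) (not_lt.1 hn)
    linarith
  refine ⟨?_, ?_, ?_⟩
  · by_contra hn
    have : (-a + b + c) * ((a - b + c) * (a + b - c)) ≤ 0 :=
      mul_nonpos_of_nonpos_of_nonneg (not_lt.1 hn)
        (mul_nonneg (by linarith) (by linarith))
    nlinarith
  · by_contra hn
    have : (a - b + c) * ((-a + b + c) * (a + b - c)) ≤ 0 :=
      mul_nonpos_of_nonpos_of_nonneg (not_lt.1 hn)
        (mul_nonneg (by linarith) (by linarith))
    nlinarith
  · by_contra hn
    have : (a + b - c) * ((-a + b + c) * (a - b + c)) ≤ 0 :=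
      mul_nonpos_of_nonpos_of_nonneg (not_lt.1 hn)
        (mul_nonneg (by linarith) (by linarith))
    nlinarith

def sg1 : Fin 4 → ℝ := ![1, -1, 1, 1]
def sg2 : Fin 4 → ℝ := ![1, 1, -1, 1]
def sg3 : Fin 4 → ℝ := ![1, 1, 1, -1]

/-- The four sign regions. -/
def Wreg (i : Fin 4) : Set (ℝ × ℝ) :=
  {p | 0 < sg1 i * rho1 (p.1, p.2, 1) ∧ 0 < sg2 i * rho2 (p.1, p.2, 1) ∧
    0 < sg3 i * rho3 (p.1, p.2, 1)}

theorem Wreg_disj (i j : Fin 4) (p : ℝ × ℝ) (hi : p ∈ Wreg i) (hj : p ∈ Wreg j) : i = j := by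
  obtain ⟨h1, h2, h3⟩ := hi
  obtain ⟨g1, g2, g3⟩ := hj
  fin_cases i <;> fin_cases j <;> simp [sg1, sg2, sg3] at * <;> linarith

/-- Signed square root vector. -/
noncomputable def av (t : ℝ) (i : Fin 4) (q : ℝ × ℝ × ℝ) : ℝ × ℝ × ℝ :=
  (sg1 i * √(q.1 + (1 - t) / (3 * t) * (q.1 + q.2.1 + q.2.2)),
   sg2 i * √(q.2.1 + (1 - t) / (3 * t) * (q.1 + q.2.1 + q.2.2)),
   sg3 i * √(q.2.2 + (1 - t) / (3 * t) * (q.1 + q.2.1 + q.2.2)))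

/-- Inverse branch. -/
noncomputable def phi (t : ℝ) (i : Fin 4) (q : ℝ × ℝ × ℝ) : ℝ × ℝ :=
  (((av t i q).1 * rho1 (av t i q)) / ((av t i q).2.2 * rho3 (av t i q)),
   ((av t i q).2.1 * rho2 (av t i q)) / ((av t i q).2.2 * rho3 (av t i q)))

theorem av_facts {t : ℝ} (ht : t ∈ Set.Ioo (0 : ℝ) 1) (i : Fin 4) (q : ℝ × ℝ × ℝ)
    (hs : 0 < q.1 + q.2.1 + q.2.2) (hQ : Qf q.1 q.2.1 q.2.2 ≤ 0) :
    (av t i q).1 ^ 2 = q.1 + (1 - t) / (3 * t) * (q.1 + q.2.1 + q.2.2) ∧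
    (av t i q).2.1 ^ 2 = q.2.1 + (1 - t) / (3 * t) * (q.1 + q.2.1 + q.2.2) ∧
    (av t i q).2.2 ^ 2 = q.2.2 + (1 - t) / (3 * t) * (q.1 + q.2.1 + q.2.2) ∧
    (av t i q).2.2 ≠ 0 ∧
    0 < rho1 (av t i q) * rho2 (av t i q) * rho3 (av t i q) ∧
    0 < rho1 (av t i q) + rho2 (av t i q) + rho3 (av t i q) ∧
    0 < sg1 i * ((av t i q).2.2 * rho2 (av t i q)) ∧
    0 < sg2 i * ((av t i q).2.2 * rho1 (av t i q)) ∧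
    0 < sg3 i * (av t i q).2.2 := by
  obtain ⟨ht0, ht1⟩ := ht
  obtain ⟨u, v, w⟩ := q
  simp only at hs hQ
  have hk : 0 < (1 - t) / (3 * t) := div_pos (by linarith) (by linarith)
  simp only [av]
  set k := (1 - t) / (3 * t) with hkdef
  have hQ' : Qf (u + k * (u + v + w)) (v + k * (u + v + w)) (w + k * (u + v + w)) < 0 := by
    have : Qf (u + k * (u + v + w)) (v + k * (u + v + w)) (w + k * (u + v + w))
      = Qf u v w - (2 * k + 3 * k ^ 2) * (u + v + w) ^ 2 := by unfold Qf; ring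
    rw [this]
    have : 0 < (2 * k + 3 * k ^ 2) * (u + v + w) ^ 2 := by positivity
    linarith
  have hs' : 0 < (u + k * (u + v + w)) + (v + k * (u + v + w)) + (w + k * (u + v + w)) := by
    have : 0 < k * (u + v + w) := by positivity
    linarith
  obtain ⟨h1, h2, h3⟩ := Qf_pos_coords hQ' hs'
  set y1 := u + k * (u + v + w)
  set y2 := v + k * (u + v + w)
  set y3 := w + k * (u + v + w)
  have e1 : √y1 ^ 2 = y1 := Real.sq_sqrt h1.le
  have e2 : √y2 ^ 2 = y2 := Real.sq_sqrt h2.le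
  have e3 : √y3 ^ 2 = y3 := Real.sq_sqrt h3.le
  have p1 : 0 < √y1 := Real.sqrt_pos.2 h1
  have p2 : 0 < √y2 := Real.sqrt_pos.2 h2
  have p3 : 0 < √y3 := Real.sqrt_pos.2 h3
  obtain ⟨t1, t2, t3⟩ := triangle p1 p2 p3 (by rw [e1, e2, e3]; exact hQ')
  refine ⟨?_, ?_, ?_, ?_, ?_⟩
  · rw [mul_pow, e1]; fin_cases i <;> simp [sg1]
  · rw [mul_pow, e2]; fin_cases i <;> simp [sg2]
  · rw [mul_pow, e3]; fin_cases i <;> simp [sg3]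
  · fin_cases i <;> simp [sg3] <;> exact p3.ne'
  generalize √y1 = a at *
  generalize √y2 = b at *
  generalize √y3 = c at *
  have hsum : 0 < a + b + c := by positivity
  have m12 := mul_pos t1 t2
  have m13 := mul_pos t1 t3
  have m23 := mul_pos t2 t3
  have m123 := mul_pos m12 t3
  have n12 := mul_pos hsum m12
  have n13 := mul_pos hsum m13
  have n23 := mul_pos hsum m23
  have c1 := mul_pos p3 t1
  have c2 := mul_pos p3 t2
  have c3 := mul_pos p3 t3
  have c4 := mul_pos p3 hsum
  refine ⟨?_, ?_, ?_, ?_, ?_⟩ <;> fin_cases i <;> simp [sg1, sg2, sg3, rho1, rho2, rho3] <;> linarith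

theorem phi_facts {t : ℝ} (ht : t ∈ Set.Ioo (0 : ℝ) 1) (i : Fin 4) (q : ℝ × ℝ × ℝ)
    (hs : 0 < q.1 + q.2.1 + q.2.2) (hQ : Qf q.1 q.2.1 q.2.2 ≤ 0) :
    (av t i q).2.2 * rho3 (av t i q) ≠ 0 ∧ phi t i q ∈ U ∧ phi t i q ∈ Wreg i ∧
    ∃ R : ℝ, R ≠ 0 ∧ ft t ((phi t i q).1, (phi t i q).2, 1) = R • q := by
  obtain ⟨e1, e2, e3, n3, hr, hrs, g1, g2, g3⟩ := av_facts ht i q hs hQ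
  obtain ⟨ht0, ht1⟩ := ht
  obtain ⟨u, v, w⟩ := q
  unfold phi
  generalize av t i (u, v, w) = A at *
  obtain ⟨a, b, c⟩ := A
  simp only [rho1, rho2, rho3] at *
  have m3 : a + b - c ≠ 0 := by intro h; rw [h] at hr; simp at hr
  have m2 : a - b + c ≠ 0 := by intro h; rw [h] at hr; simp at hr
  have m1 : -a + b + c ≠ 0 := by intro h; rw [h] at hr; simp at hr
  have hD : c * (a + b - c) ≠ 0 := mul_ne_zero n3 m3
  have hD2 : 0 < (c * (a + b - c)) ^ 2 := by positivity
  refine ⟨hD, ?_, ⟨?_, ?_, ?_⟩, ?_⟩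
  · have : (a * (-a + b + c) / (c * (a + b - c))) ^ 2 + (b * (a - b + c) / (c * (a + b - c))) ^ 2
      + 1 - 2 * (a * (-a + b + c) / (c * (a + b - c)) * (b * (a - b + c) / (c * (a + b - c)))
        + a * (-a + b + c) / (c * (a + b - c)) + b * (a - b + c) / (c * (a + b - c)))
      = -(((-a + b + c) * (a - b + c) * (a + b - c)) *
        ((-a + b + c) + (a - b + c) + (a + b - c))) / (c * (a + b - c)) ^ 2 := by
      field_simp
      ring
    change _ < (0 : ℝ)
    simp only
    rw [this]
    exact div_neg_of_neg_of_pos (neg_neg_of_pos (mul_pos hr hrs)) hD2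
  · have : sg1 i * rho1 (a * (-a + b + c) / (c * (a + b - c)), b * (a - b + c) / (c * (a + b - c)), 1)
      = sg1 i * (c * (a - b + c)) / c ^ 2 := by
      unfold rho1
      field_simp
      ring
    simp only
    rw [this]
    exact div_pos g1 (by positivity)
  · have : sg2 i * rho2 (a * (-a + b + c) / (c * (a + b - c)), b * (a - b + c) / (c * (a + b - c)), 1)
      = sg2 i * (c * (-a + b + c)) / c ^ 2 := by
      unfold rho2
      field_simp
      ring
    simp only
    rw [this]
    exact div_pos g2 (by positivity)
  · have : sg3 i * rho3 (a * (-a + b + c) / (c * (a + b - c)), b * (a - b + c) / (c * (a + b - c)), 1)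
      = sg3 i * c * ((-a + b + c) * (a - b + c) * (a + b - c)) / (c * (a + b - c)) ^ 2 := by
      unfold rho3
      field_simp
      ring
    simp only
    rw [this]
    exact div_pos (mul_pos g3 hr) hD2
  · have hsplit : (1 - t) / (3 * t) * (3 * t) = 1 - t := by field_simp
    refine ⟨((-a + b + c) * (a - b + c) * (a + b - c)) ^ 2 / (c * (a + b - c)) ^ 4, by positivity, ?_⟩
    set k := (1 - t) / (3 * t)
    have f1 : fmap (a * (-a + b + c) / (c * (a + b - c)), b * (a - b + c) / (c * (a + b - c)), 1)
      = (((-a + b + c) * (a - b + c) * (a + b - c)) ^ 2 / (c * (a + b - c)) ^ 4) •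
        (a ^ 2, b ^ 2, c ^ 2) := by
      unfold fmap rho1 rho2 rho3
      simp only [Prod.smul_mk, smul_eq_mul, Prod.mk.injEq]
      refine ⟨?_, ?_, ?_⟩ <;> field_simp <;> ring
    unfold ft
    simp only [f1, e1, e2, e3]
    simp only [Prod.smul_mk, smul_eq_mul, Prod.mk_sub_mk, Prod.mk.injEq]
    generalize ((-a + b + c) * (a - b + c) * (a + b - c)) ^ 2 / (c * (a + b - c)) ^ 4 = R
    clear_value k
    refine ⟨?_, ?_, ?_⟩
    · linear_combination (R * (u + v + w) / 3) * hsplit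
    · linear_combination (R * (u + v + w) / 3) * hsplit
    · linear_combination (R * (u + v + w) / 3) * hsplit

/-- Normalised simplex disc. -/
def Sset : Set (ℝ × ℝ × ℝ) := {q | q.1 + q.2.1 + q.2.2 = 1 ∧ Qf q.1 q.2.1 q.2.2 ≤ 0}

theorem Sset_compact : IsCompact Sset := by
  refine Metric.isCompact_of_isClosed_isBounded ?_ ?_
  · have c1 : Continuous fun q : ℝ × ℝ × ℝ => q.1 + q.2.1 + q.2.2 := by fun_prop
    have c2 : Continuous fun q : ℝ × ℝ × ℝ => Qf q.1 q.2.1 q.2.2 := by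
      unfold Qf
      fun_prop
    exact (isClosed_eq c1 continuous_const).inter (isClosed_le c2 continuous_const)
  · refine (Metric.isBounded_Icc ((-1 : ℝ), (-1 : ℝ), (-1 : ℝ)) (1, 1, 1)).subset ?_
    rintro ⟨u, v, w⟩ ⟨h1, h2⟩
    simp only [Qf] at h1 h2
    have h3 : 2 * (u ^ 2 + v ^ 2 + w ^ 2) ≤ 1 := by
      have : (u + v + w) ^ 2 = 1 := by rw [h1]; norm_num
      linarith
    refine ⟨⟨?_, ?_, ?_⟩, ⟨?_, ?_, ?_⟩⟩ <;> simp only <;> nlinarith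

theorem phi_cont {t : ℝ} (ht : t ∈ Set.Ioo (0 : ℝ) 1) (i : Fin 4) :
    ContinuousOn (phi t i) Sset := by
  have hav : Continuous (av t i) := by unfold av; fun_prop
  have hne : ∀ q ∈ Sset, (av t i q).2.2 * rho3 (av t i q) ≠ 0 := fun q hq =>
    (phi_facts ht i q (by rw [hq.1]; norm_num) hq.2).1
  have c1 : Continuous fun q => (av t i q).1 * rho1 (av t i q) := by unfold rho1; fun_prop
  have c2 : Continuous fun q => (av t i q).2.1 * rho2 (av t i q) := by unfold rho2; fun_prop
  have c3 : Continuous fun q => (av t i q).2.2 * rho3 (av t i q) := by unfold rho3; fun_prop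
  exact (c1.continuousOn.div c3.continuousOn hne).prodMk
    (c2.continuousOn.div c3.continuousOn hne)

/-- Normalisation of affine points. -/
noncomputable def nrm (p : ℝ × ℝ) : ℝ × ℝ × ℝ :=
  (p.1 / (p.1 + p.2 + 1), p.2 / (p.1 + p.2 + 1), 1 / (p.1 + p.2 + 1))

theorem U_sum {p : ℝ × ℝ} (hp : p ∈ U) : 0 < p.1 + p.2 + 1 := by
  have h : p.1 ^ 2 + p.2 ^ 2 + 1 - 2 * (p.1 * p.2 + p.1 + p.2) < 0 := hp
  nlinarith [sq_nonneg (p.1 - p.2)]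

theorem nrm_mem {p : ℝ × ℝ} (hp : p ∈ U) : nrm p ∈ Sset := by
  have hs := U_sum hp
  have h : p.1 ^ 2 + p.2 ^ 2 + 1 - 2 * (p.1 * p.2 + p.1 + p.2) < 0 := hp
  constructor
  · simp only [nrm]; field_simp
  · have : Qf (nrm p).1 (nrm p).2.1 (nrm p).2.2
      = (p.1 ^ 2 + p.2 ^ 2 + 1 - 2 * (p.1 * p.2 + p.1 + p.2)) / (p.1 + p.2 + 1) ^ 2 := by
      simp only [nrm, Qf]; field_simp; ring
    rw [this]
    exact (div_neg_of_neg_of_pos h (by positivity)).le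

theorem nrm_cont : ContinuousOn nrm U := by
  have hne : ∀ p ∈ U, p.1 + p.2 + 1 ≠ 0 := fun p hp => (U_sum hp).ne'
  have c : ContinuousOn (fun p : ℝ × ℝ => p.1 + p.2 + 1) U := by fun_prop
  exact (continuousOn_fst.div c hne).prodMk
    ((continuousOn_snd.div c hne).prodMk (continuousOn_const.div c hne))

theorem branch {t : ℝ} (ht : t ∈ Set.Ioo (0 : ℝ) 1) (i : Fin 4) {p : ℝ × ℝ} (hp : p ∈ U) :
    (ft t ((phi t i (nrm p)).1, (phi t i (nrm p)).2, 1)).2.2 ≠ 0 ∧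
    Ft t (phi t i (nrm p)) = p := by
  have hq := nrm_mem hp
  obtain ⟨_, _, _, R, hR, hft⟩ := phi_facts ht i (nrm p) (by rw [hq.1]; norm_num) hq.2
  have hs := U_sum hp
  unfold Ft
  rw [hft]
  simp only [nrm, Prod.smul_mk, smul_eq_mul]
  refine ⟨by positivity, ?_⟩
  ext <;> simp only <;> field_simp

theorem Ft_cont (t : ℝ) {A : Set (ℝ × ℝ)} (h : ∀ p ∈ A, (ft t (p.1, p.2, 1)).2.2 ≠ 0) :
    ContinuousOn (Ft t) A := by
  have c : Continuous fun p : ℝ × ℝ => ft t (p.1, p.2, 1) := by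
    unfold ft fmap rho1 rho2 rho3; fun_prop
  have c3 : Continuous fun p : ℝ × ℝ => (ft t (p.1, p.2, 1)).2.2 := c.snd.snd
  have c2 : Continuous fun p : ℝ × ℝ => (ft t (p.1, p.2, 1)).2.1 := c.snd.fst
  have c1 : Continuous fun p : ℝ × ℝ => (ft t (p.1, p.2, 1)).1 := c.fst
  exact (c1.continuousOn.div c3.continuousOn h).prodMk (c2.continuousOn.div c3.continuousOn h)

/-- For every t ∈ (0,1) there are a nonempty compact K ⊂ U, invariant under
F_t (which is defined on K), and a continuous surjection ι from K onto the
one-sided 4-shift semiconjugating F_t|K to the shift σ. -/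
theorem stmt_19 (t : ℝ) (ht : t ∈ Set.Ioo (0 : ℝ) 1) :
    ∃ K : Set (ℝ × ℝ), K.Nonempty ∧ IsCompact K ∧ K ⊆ U ∧
      ∃ ι : (ℝ × ℝ) → (ℕ → Fin 4),
        ContinuousOn ι K ∧
        (∀ s : ℕ → Fin 4, ∃ p ∈ K, ι p = s) ∧
        (∀ p ∈ K, (ft t (p.1, p.2, 1)).2.2 ≠ 0 ∧ Ft t p ∈ K) ∧
        (∀ p ∈ K, ι (Ft t p) = fun n => ι p (n + 1)) := by
  have hS : ∀ i, ∀ q ∈ Sset, phi t i q ∈ U ∧ phi t i q ∈ Wreg i := by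
    intro i q hq
    have := phi_facts ht i q (by rw [hq.1]; norm_num) hq.2
    exact ⟨this.2.1, this.2.2.1⟩
  let C : Set (ℝ × ℝ) := ⋃ i, phi t i '' Sset
  have hC : IsCompact C := isCompact_iUnion fun i => Sset_compact.image_of_continuousOn (phi_cont ht i)
  have hCU : C ⊆ U := by
    intro p hp
    obtain ⟨i, q, hq, rfl⟩ := Set.mem_iUnion.1 hp
    exact (hS i q hq).1
  let E : Fin 4 → Set (ℝ × ℝ) := fun i => (fun p => phi t i (nrm p)) '' C
  have hE : ∀ i, IsCompact (E i) := fun i => hC.image_of_continuousOn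
    ((phi_cont ht i).comp (nrm_cont.mono hCU) (fun p hp => nrm_mem (hCU hp)))
  have hEC : (⋃ i, E i) ⊆ C := by
    intro p hp
    obtain ⟨i, q, hq, rfl⟩ := Set.mem_iUnion.1 hp
    exact Set.mem_iUnion.2 ⟨i, nrm q, nrm_mem (hCU hq), rfl⟩
  have hden : ∀ p ∈ ⋃ i, E i, (ft t (p.1, p.2, 1)).2.2 ≠ 0 := by
    intro p hp
    obtain ⟨i, q, hq, rfl⟩ := Set.mem_iUnion.1 hp
    exact (branch ht i (hCU hq)).1
  have h11 : ((1 : ℝ), (1 : ℝ)) ∈ U := by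
    change (_ : ℝ) < 0
    norm_num
  have hc0 : phi t 0 (nrm (1, 1)) ∈ C := Set.mem_iUnion.2 ⟨0, _, nrm_mem h11, rfl⟩
  obtain ⟨K, hK, hKc, hKE, ι, h1, h2, h3, h4⟩ := horseshoe (Ft t) E (fun i p => phi t i (nrm p))
    (phi t 0 (nrm (phi t 0 (nrm (1, 1))))) (Set.mem_iUnion.2 ⟨0, _, hc0, rfl⟩) hE
    (by
      rintro i j p ⟨q, hq, rfl⟩ ⟨r, hr, hrq⟩
      refine Wreg_disj i j _ (hS i _ (nrm_mem (hCU hq))).2 ?_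
      change (fun p => phi t i (nrm p)) q ∈ Wreg j
      rw [← hrq]
      exact (hS j _ (nrm_mem (hCU hr))).2)
    (Ft_cont t hden)
    (fun i p hp => ⟨⟨p, hEC hp, rfl⟩, (branch ht i (hCU (hEC hp))).2⟩)
  exact ⟨K, hK, hKc, hKE.trans (hEC.trans hCU), ι, h1, h2,
    fun p hp => ⟨hden p (hKE hp), h3 p hp⟩, h4⟩
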